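/- Let (W,S) be a finite Coxeter system and let ≪ be a linear order on W whose least element is the identity 1. Let φ_≪ : W → Sym(W) be the (Cayley) homomorphism defined by φ_≪(w)(u) = u·w⁻¹ for u, w ∈ W, where Sym(W) is identified with Sym(|W|) via the order isomorphism of (W,≪) with {1, …, |W|}. Then the following are equivalent: (i) ≪ is a refinement of the Bruhat order on W, i.e., u <_B v implies u ≪ v for all u, v ∈ W; (ii) φ_≪ is a strong E-embedding. -/

import Mathlib

open Equiv

/-- The inversion number of a permutation of `Fin n`. -/
def permInvNum {n : ℕ} (σ : Equiv.Perm (Fin n)) : ℕ :=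
  (Finset.univ.filter (fun p : Fin n × Fin n => p.1 < p.2 ∧ σ p.2 < σ p.1)).card

/-- The strict Bruhat order on the symmetric group `Sym(n)`. -/
def permBruhatLT {n : ℕ} : Equiv.Perm (Fin n) → Equiv.Perm (Fin n) → Prop :=
  Relation.TransGen (fun a b => ∃ t : Equiv.Perm (Fin n), t.IsSwap ∧ b = a * t ∧
    permInvNum a < permInvNum b)

/-- The strict Bruhat order on a Coxeter group. -/
def coxBruhatLT {B W : Type*} [Group W] {M : CoxeterMatrix B} (cs : CoxeterSystem M W) :
    W → W → Prop :=
  Relation.TransGen (fun u v => ∃ t : W, cs.IsReflection t ∧ v = u * t ∧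
    cs.length u < cs.length v)

/-- The condition defining strong E-embeddings. -/
def StrongECond {B W : Type*} [Group W] {M : CoxeterMatrix B} (cs : CoxeterSystem M W)
    {n : ℕ} (φ : W →* Equiv.Perm (Fin n)) : Prop :=
  ∀ (w : W) (i : B), cs.length (w * cs.simple i) = cs.length w + 1 →
    ∀ a : Fin n, φ (cs.simple i) a ≠ a →
      permBruhatLT (φ w) (φ w * Equiv.swap a (φ (cs.simple i) a))

/-- A strong E-embedding. -/
def IsStrongEEmbedding {B W : Type*} [Group W] {M : CoxeterMatrix B} (cs : CoxeterSystem M W)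
    {n : ℕ} (φ : W →* Equiv.Perm (Fin n)) : Prop :=
  Function.Injective φ ∧ StrongECond cs φ

/-- The right-regular Cayley embedding `W →* Sym(|W|)` induced by a linear order `lo` on `W`:
`w` acts by `u ↦ u * w⁻¹`, with `W` identified with `Fin |W|` via the order isomorphism
determined by `lo`. -/
noncomputable def cayleyHom (W : Type*) [Group W] [Fintype W] (lo : LinearOrder W) :
    W →* Equiv.Perm (Fin (Fintype.card W)) :=
  letI := lo
  letI e : Fin (Fintype.card W) ≃o W := monoEquivOfFin W rfl
  { toFun := fun w => (e.toEquiv.trans (Equiv.mulRight w⁻¹)).trans e.symm.toEquiv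
    map_one' := by ext i; simp
    map_mul' := by intro a b; ext i; simp [mul_assoc] }

theorem Function.End.mul_apply_eq {α : Type*} (f g : Function.End α) (x : α) :
    (f * g) x = f (g x) := rfl

theorem Function.End.one_apply_eq {α : Type*} (x : α) : (1 : Function.End α) x = x := rfl

namespace CoxeterSystem

variable {B W : Type*} [Group W] {M : CoxeterMatrix B} (cs : CoxeterSystem M W)

open scoped Classical in
/-- The action of a simple reflection on `W × ZMod 2`: conjugation on the first coordinate, and a
change of sign exactly at the simple reflection itself. -/
noncomputable def signedConj (i : B) : Function.End (W × ZMod 2) := fun p =>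
  (cs.simple i * p.1 * cs.simple i, p.2 + if p.1 = cs.simple i then 1 else 0)

theorem simple_mul_pow_mul_simple_mul (i j : B) (n : ℕ) :
    cs.simple j * (cs.simple i * cs.simple j) ^ n * cs.simple j =
      ((cs.simple i * cs.simple j) ^ n)⁻¹ := by
  have h := conj_pow (i := n) (a := cs.simple j) (b := cs.simple i * cs.simple j)
  rw [cs.inv_simple] at h
  rw [← h, ← inv_pow]
  simp [mul_assoc]

open scoped Classical in
theorem signedConj_mul_pow_apply (i j : B) (n : ℕ) (p : W × ZMod 2) :
    ((cs.signedConj i * cs.signedConj j) ^ n : Function.End (W × ZMod 2)) p =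
      ((cs.simple i * cs.simple j) ^ n * p.1 * ((cs.simple i * cs.simple j) ^ n)⁻¹,
        p.2 + ∑ k ∈ Finset.range (2 * n),
          if p.1 = cs.simple j * (cs.simple i * cs.simple j) ^ k then 1 else 0) := by
  induction n with
  | zero => simp [Function.End.one_apply_eq]
  | succ n ih =>
    have hs := cs.simple_mul_pow_mul_simple_mul i j n
    set q := cs.simple i * cs.simple j with hq
    have hcomm : (q ^ n)⁻¹ * cs.simple j = cs.simple j * q ^ n := by
      rw [← hs]; simp [mul_assoc]
    have h₁ : q ^ n * p.1 * (q ^ n)⁻¹ = cs.simple j ↔ p.1 = cs.simple j * q ^ (2 * n) := by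
      rw [mul_inv_eq_iff_eq_mul, ← eq_inv_mul_iff_mul_eq, ← mul_assoc, hcomm, mul_assoc,
        ← pow_add, two_mul]
    have h₂ : cs.simple j * (q ^ n * p.1 * (q ^ n)⁻¹) * cs.simple j = cs.simple i ↔
        p.1 = cs.simple j * q ^ (2 * n + 1) := by
      have h : cs.simple j * (q ^ n * p.1 * (q ^ n)⁻¹) * cs.simple j = cs.simple i ↔
          q ^ n * p.1 * (q ^ n)⁻¹ = cs.simple j * q := by
        rw [← eq_mul_inv_iff_mul_eq, ← eq_inv_mul_iff_mul_eq, cs.inv_simple]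
      rw [h, mul_inv_eq_iff_eq_mul, ← eq_inv_mul_iff_mul_eq, ← mul_assoc, ← mul_assoc, hcomm,
        mul_assoc, mul_assoc, ← pow_succ', ← pow_add]
      ring_nf
    rw [pow_succ', Function.End.mul_apply_eq, ih, Function.End.mul_apply_eq, mul_add, mul_one,
      Finset.sum_range_succ, Finset.sum_range_succ]
    simp only [signedConj, h₁, h₂]
    ext
    · simp [hq, pow_succ', mul_assoc]
    · simp only [add_assoc]

theorem isLiftable_signedConj : M.IsLiftable cs.signedConj := by
  classical
  intro i j
  funext p
  rw [cs.signedConj_mul_pow_apply, two_mul, Finset.sum_range_add]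
  simp [pow_add, CharTwo.add_self_eq_zero, Function.End.one_apply_eq]

/-- The cocycle `W → W → ZMod 2` whose value at a reflection `t` records whether `t` is a right
inversion. -/
noncomputable def inversionParity (w x : W) : ZMod 2 :=
  (cs.lift ⟨cs.signedConj, cs.isLiftable_signedConj⟩ w (x, 0)).2

theorem lift_signedConj_apply (w : W) (p : W × ZMod 2) :
    cs.lift ⟨cs.signedConj, cs.isLiftable_signedConj⟩ w p =
      (w * p.1 * w⁻¹, p.2 + cs.inversionParity w p.1) := by
  induction w using cs.simple_induction_left generalizing p with
  | one => simp [inversionParity, Function.End.one_apply_eq]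
  | mul_simple_left w i ih =>
    rw [inversionParity, map_mul, Function.End.mul_apply_eq, Function.End.mul_apply_eq, ih, ih,
      cs.lift_apply_simple]
    simp [signedConj, mul_assoc, add_assoc]

theorem inversionParity_mul (v w x : W) :
    cs.inversionParity (v * w) x =
      cs.inversionParity w x + cs.inversionParity v (w * x * w⁻¹) := by
  rw [inversionParity, map_mul, Function.End.mul_apply_eq,
    cs.lift_signedConj_apply w, cs.lift_signedConj_apply v]
  simp

@[simp] theorem inversionParity_one (x : W) : cs.inversionParity 1 x = 0 := by
  simp [inversionParity, Function.End.one_apply_eq]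

open scoped Classical in
theorem inversionParity_simple (i : B) (x : W) :
    cs.inversionParity (cs.simple i) x = if x = cs.simple i then 1 else 0 := by
  simp [inversionParity, cs.lift_apply_simple, signedConj]

theorem inversionParity_inv_conj (w x : W) :
    cs.inversionParity w⁻¹ (w * x * w⁻¹) = cs.inversionParity w x := by
  have h := cs.inversionParity_mul w⁻¹ w x
  rw [inv_mul_cancel, inversionParity_one] at h
  exact (CharTwo.add_eq_zero.mp h.symm).symm

theorem inversionParity_mul_inv_conj (u w x : W) :
    cs.inversionParity (u * w⁻¹) (w * x * w⁻¹) =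
      cs.inversionParity w x + cs.inversionParity u x := by
  rw [inversionParity_mul, inversionParity_inv_conj]
  simp [mul_assoc]

theorem IsReflection.inversionParity_self {t : W} (ht : cs.IsReflection t) :
    cs.inversionParity t t = 1 := by
  obtain ⟨w, i, rfl⟩ := ht
  rw [inversionParity_mul_inv_conj, inversionParity_mul]
  simp [inversionParity_simple, add_left_comm _ (1 : ZMod 2), CharTwo.add_self_eq_zero]

theorem inversionParity_wordProd_of_notMem {ω : List B} {x : W} (hx : x ∉ cs.rightInvSeq ω) :
    cs.inversionParity (cs.wordProd ω) x = 0 := by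
  induction ω with
  | nil => simp
  | cons i ω ih =>
    simp only [rightInvSeq, List.mem_cons, not_or] at hx
    rw [wordProd_cons, inversionParity_mul, ih hx.2, inversionParity_simple, if_neg, add_zero]
    rintro h
    apply hx.1
    rw [← h]
    group

theorem length_mul_lt_of_inversionParity_ne_zero {w x : W} (h : cs.inversionParity w x ≠ 0) :
    cs.length (w * x) < cs.length w := by
  obtain ⟨ω, hω, rfl⟩ := cs.exists_isReduced w
  by_contra hlt
  exact h <| cs.inversionParity_wordProd_of_notMem fun hx =>
    hlt (cs.isRightInversion_of_mem_rightInvSeq hω hx).2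

theorem IsReflection.length_lt_length_mul_iff {t : W} (ht : cs.IsReflection t) (w : W) :
    cs.length w < cs.length (w * t) ↔ cs.inversionParity w t = 0 := by
  refine ⟨fun h => ?_, fun h => ?_⟩
  · by_contra h'
    exact h.not_gt (cs.length_mul_lt_of_inversionParity_ne_zero h')
  · have h' : cs.inversionParity (w * t) t ≠ 0 := by
      rw [inversionParity_mul, ht.inversionParity_self]
      simp [h]
    simpa [mul_assoc, ht.mul_self] using cs.length_mul_lt_of_inversionParity_ne_zero h'

/-- If `w` does not have `s` as a right descent, then multiplying the pair `u`, `u * s` on the right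
by `w⁻¹` preserves which of the two is longer. -/
theorem length_mul_inv_lt_iff {w : W} {i : B} (hw : cs.length w < cs.length (w * cs.simple i))
    (u : W) :
    cs.length (u * w⁻¹) < cs.length (u * cs.simple i * w⁻¹) ↔
      cs.length u < cs.length (u * cs.simple i) := by
  have hs := cs.isReflection_simple i
  have h : u * cs.simple i * w⁻¹ = u * w⁻¹ * (w * cs.simple i * w⁻¹) := by group
  rw [h, (hs.conj w).length_lt_length_mul_iff, hs.length_lt_length_mul_iff,
    inversionParity_mul_inv_conj, (hs.length_lt_length_mul_iff cs w).mp hw, zero_add]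

end CoxeterSystem

theorem permInvNum_lt_mul_swap {n : ℕ} {σ : Equiv.Perm (Fin n)} {a b : Fin n} (hab : a < b)
    (hσ : σ a < σ b) : permInvNum σ < permInvNum (σ * Equiv.swap a b) := by
  set τ := Equiv.swap a b with hτ
  have hτa : τ a = b := Equiv.swap_apply_left a b
  have hτb : τ b = a := Equiv.swap_apply_right a b
  have hττ (x : Fin n) : τ (τ x) = x := Equiv.swap_apply_self a b x
  have hτx (x : Fin n) (ha : x ≠ a) (hb : x ≠ b) : τ x = x :=
    Equiv.swap_apply_of_ne_of_ne ha hb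
  let g : Fin n × Fin n → Fin n × Fin n := fun p => if τ p.1 < τ p.2 then (τ p.1, τ p.2) else p
  have hg : Set.InjOn g
      (Finset.univ.filter fun p : Fin n × Fin n => p.1 < p.2 ∧ σ p.2 < σ p.1) := by
    rintro ⟨p, q⟩ hp ⟨p', q'⟩ hp' h
    simp only [Finset.coe_filter, Finset.mem_univ, true_and, Set.mem_ofPred_eq] at hp hp'
    grind
  rw [permInvNum, permInvNum, ← Finset.card_image_of_injOn hg]
  apply Finset.card_lt_card
  rw [Finset.ssubset_iff_of_subset]
  · refine ⟨(a, b), Finset.mem_filter.mpr (by simp [hab, hτa, hτb, hσ]), ?_⟩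
    simp only [Finset.mem_image, Finset.mem_filter, Finset.mem_univ, true_and, Prod.exists]
    rintro ⟨p, q, hp, h⟩
    grind
  · rintro _ hx
    obtain ⟨⟨p, q⟩, hp, rfl⟩ := Finset.mem_image.mp hx
    simp only [Finset.mem_filter, Finset.mem_univ, true_and, Equiv.Perm.mul_apply] at hp ⊢
    grind

theorem permInvNum_lt_of_permBruhatLT {n : ℕ} {σ τ : Equiv.Perm (Fin n)}
    (h : permBruhatLT σ τ) : permInvNum σ < permInvNum τ := by
  induction h with
  | single h => exact h.choose_spec.2.2
  | tail _ h ih => exact ih.trans h.choose_spec.2.2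

theorem permBruhatLT_mul_swap_iff_of_lt {n : ℕ} (σ : Equiv.Perm (Fin n)) {a b : Fin n}
    (hab : a < b) : permBruhatLT σ (σ * Equiv.swap a b) ↔ σ a < σ b := by
  refine ⟨fun h => ?_, fun h => .single
    ⟨_, ⟨a, b, hab.ne, rfl⟩, rfl, permInvNum_lt_mul_swap hab h⟩⟩
  by_contra hle
  have hlt : σ b < σ a := lt_of_le_of_ne (not_lt.mp hle) (σ.injective.ne hab.ne')
  have h' := permInvNum_lt_mul_swap (σ := σ * Equiv.swap a b) hab (by simpa using hlt)
  rw [mul_assoc, Equiv.swap_mul_self, mul_one] at h'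
  exact h'.not_gt (permInvNum_lt_of_permBruhatLT h)

theorem permBruhatLT_mul_swap_iff {n : ℕ} (σ : Equiv.Perm (Fin n)) {a b : Fin n} (hab : a ≠ b) :
    permBruhatLT σ (σ * Equiv.swap a b) ↔ (a < b ↔ σ a < σ b) := by
  rcases hab.lt_or_gt with h | h
  · simp [permBruhatLT_mul_swap_iff_of_lt σ h, h]
  · rw [Equiv.swap_comm, permBruhatLT_mul_swap_iff_of_lt σ h]
    have := σ.injective.ne hab
    grind

theorem cayleyHom_injective {W : Type*} [Group W] [Fintype W] (lo : LinearOrder W) :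
    Function.Injective (cayleyHom W lo) := by
  let _ := lo
  intro v w h
  have h' := DFunLike.congr_fun h ((monoEquivOfFin W rfl).symm 1)
  simpa [cayleyHom] using h'

theorem strongECond_cayleyHom_iff {B W : Type*} [Group W] [Fintype W] {M : CoxeterMatrix B}
    (cs : CoxeterSystem M W) (lo : LinearOrder W) :
    StrongECond cs (cayleyHom W lo) ↔
      ∀ (w : W) (i : B), cs.length w < cs.length (w * cs.simple i) → ∀ u : W,
        (lo.lt u (u * cs.simple i) ↔ lo.lt (u * w⁻¹) (u * cs.simple i * w⁻¹)) := by
  let _ := lo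
  let e : Fin (Fintype.card W) ≃o W := monoEquivOfFin W rfl
  have he (w : W) (a : Fin (Fintype.card W)) :
      cayleyHom W lo w a = e.symm (e a * w⁻¹) := rfl
  have hlen (w : W) (i : B) : cs.length (w * cs.simple i) = cs.length w + 1 ↔
      cs.length w < cs.length (w * cs.simple i) := by
    rcases cs.length_mul_simple w i with h | h <;> omega
  have hne (u : W) (i : B) : u * cs.simple i ≠ u := fun h =>
    cs.length_mul_simple_ne u i (by rw [h])
  unfold StrongECond
  simp only [hlen]
  refine forall₃_congr fun w i _ => e.toEquiv.forall_congr fun a => ?_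
  have ha : cayleyHom W lo (cs.simple i) a ≠ a := by
    rw [he, cs.inv_simple, Ne, e.symm_apply_eq]
    exact hne _ _
  rw [forall_prop_of_true ha, permBruhatLT_mul_swap_iff _ ha.symm]
  simp only [he, cs.inv_simple, e.apply_symm_apply, e.symm.lt_iff_lt, e.lt_symm_apply]
  rfl

theorem stmt3 {B W : Type*} [Group W] [Fintype W] {M : CoxeterMatrix B}
    (cs : CoxeterSystem M W) (lo : LinearOrder W)
    (hlo1 : ∀ w : W, lo.le 1 w) :
    (∀ u v : W, coxBruhatLT cs u v → lo.lt u v) ↔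
      IsStrongEEmbedding cs (cayleyHom W lo) := by
  rw [IsStrongEEmbedding, and_iff_right (cayleyHom_injective lo), strongECond_cayleyHom_iff]
  let _ := lo
  constructor
  · intro h w i hw u
    have key {x t : W} (ht : cs.IsReflection t) :
        lo.lt x (x * t) ↔ cs.length x < cs.length (x * t) := by
      refine ⟨fun hx => ?_, fun hx => h _ _ (.single ⟨t, ht, rfl, hx⟩)⟩
      by_contra hle
      have hlt := lt_of_le_of_ne (not_lt.mp hle) (ht.length_mul_left_ne x)
      exact lt_asymm (α := W) hx (h _ _ (.single ⟨t, ht, by simp [mul_assoc, ht.mul_self], hlt⟩))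
    have hs := cs.isReflection_simple i
    rw [key hs, ← cs.length_mul_inv_lt_iff hw u,
      show u * cs.simple i * w⁻¹ = u * w⁻¹ * (w * cs.simple i * w⁻¹) by group,
      key (hs.conj w)]
  · intro h
    have weak (u : W) (i : B) (hu : cs.length u < cs.length (u * cs.simple i)) :
        lo.lt u (u * cs.simple i) := by
      rw [h u i hu u, mul_inv_cancel]
      refine lt_of_le_of_ne (α := W) (hlo1 _) fun h1 => cs.length_mul_simple_ne u i ?_
      rw [mul_inv_eq_one.mp h1.symm]
    have step (x w : W) (i : B) (hw : cs.length w < cs.length (w * cs.simple i))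
        (hx : cs.length x < cs.length (x * (w * cs.simple i * w⁻¹))) :
        lo.lt x (x * (w * cs.simple i * w⁻¹)) := by
      have hx' : x * w * w⁻¹ = x := by group
      have hxt : x * w * cs.simple i * w⁻¹ = x * (w * cs.simple i * w⁻¹) := by group
      rw [← hxt]
      nth_rw 1 [← hx']
      rw [← h w i hw]
      apply weak
      rwa [← cs.length_mul_inv_lt_iff hw, hx', hxt]
    have cover {u v : W} (huv : ∃ t : W, cs.IsReflection t ∧ v = u * t ∧
        cs.length u < cs.length v) : lo.lt u v := by
      obtain ⟨_, ⟨w, i, rfl⟩, rfl, hlt⟩ := huv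
      rcases (cs.length_mul_simple_ne w i).lt_or_gt with hw | hw
      · have ht : w * cs.simple i * w⁻¹ =
            w * cs.simple i * cs.simple i * (w * cs.simple i)⁻¹ := by
          simp [mul_assoc]
        rw [ht] at hlt ⊢
        exact step u _ i (by simpa using hw) hlt
      · exact step u w i hw hlt
    intro u v huv
    induction huv with
    | single h => exact cover h
    | tail _ h ih => exact lt_trans (α := W) ih (cover h)
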